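/- arXiv:2302.04209 — 2 statements merged into one kernel-verified Lean document; each statement's English description precedes it below -/
import Mathlib

section
/- Let P ∈ ℝ[x,y] be irreducible of degree d, let Γ = {(x,y) ∈ ℝ² : P(x,y) = 0}, and let k be an integer with 1 ≤ k < d. Let Γ° be a connected component of Γ \ Σ_k. Then for every nonzero polynomial Q ∈ ℝ[x,y] of degree at most k, the set Γ° ∩ {Q = 0} has fewer than μ = (k+1)(k+2)/2 elements. -/
/-- Evaluation of a polynomial in two variables at a point of `ℝ²`. -/
noncomputable def evalRR (Q : MvPolynomial (Fin 2) ℝ) (p : ℝ × ℝ) : ℝ :=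
  MvPolynomial.eval ![p.1, p.2] Q

/-- The derivation `L = L_P = P_y ∂/∂x - P_x ∂/∂y` applied to `Q`. -/
noncomputable def Lop (P Q : MvPolynomial (Fin 2) ℝ) : MvPolynomial (Fin 2) ℝ :=
  MvPolynomial.pderiv 1 P * MvPolynomial.pderiv 0 Q -
    MvPolynomial.pderiv 0 P * MvPolynomial.pderiv 1 Q

/-- `f : Fin μ → ℝ[x,y]` is an enumeration of the monomials `x^a y^b` with `a + b ≤ k`. -/
def IsMonomialEnum (k : ℕ) {μ : ℕ} (f : Fin μ → MvPolynomial (Fin 2) ℝ) : Prop :=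
  Function.Injective f ∧
    Set.range f =
      {q | ∃ a b : ℕ, a + b ≤ k ∧ q = MvPolynomial.X 0 ^ a * MvPolynomial.X 1 ^ b}

/-- The `j`-th partial `ξ`-Wronskian: the determinant of the `j × j` matrix with
`(i, m)` entry `L^{i-1} f_m` (with `0`-based indexing, `L^i f_m`). -/
noncomputable def xiWronskian (P : MvPolynomial (Fin 2) ℝ) {μ : ℕ}
    (f : Fin μ → MvPolynomial (Fin 2) ℝ) (j : ℕ) (hj : j ≤ μ) : MvPolynomial (Fin 2) ℝ :=
  Matrix.det (Matrix.of fun i m : Fin j => (Lop P)^[(i : ℕ)] (f (Fin.castLE hj m)))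

/-- The set `Σ_k`: the union of `{P_x = P_y = P = 0}` with the zero sets of the
partial `ξ`-Wronskians `W_j` for `j = 1, …, μ`. -/
noncomputable def SigmaSet (P : MvPolynomial (Fin 2) ℝ) {μ : ℕ}
    (f : Fin μ → MvPolynomial (Fin 2) ℝ) : Set (ℝ × ℝ) :=
  {p | (evalRR (MvPolynomial.pderiv 0 P) p = 0 ∧ evalRR (MvPolynomial.pderiv 1 P) p = 0 ∧
          evalRR P p = 0) ∨
       ∃ (j : ℕ) (hj : j ≤ μ), 1 ≤ j ∧ evalRR (xiWronskian P f j hj) p = 0}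


noncomputable def LD (P : MvPolynomial (Fin 2) ℝ) :
    Derivation ℝ (MvPolynomial (Fin 2) ℝ) (MvPolynomial (Fin 2) ℝ) :=
  MvPolynomial.pderiv 1 P • MvPolynomial.pderiv 0 - MvPolynomial.pderiv 0 P • MvPolynomial.pderiv 1

lemma Lop_eq (P Q : MvPolynomial (Fin 2) ℝ) : Lop P Q = LD P Q := by
  simp [LD, Lop]

lemma Lop_mul (P a b : MvPolynomial (Fin 2) ℝ) : Lop P (a * b) = Lop P a * b + a * Lop P b := by
  simp only [Lop_eq, Derivation.leibniz, smul_eq_mul]; ring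

lemma Lop_add (P a b : MvPolynomial (Fin 2) ℝ) : Lop P (a + b) = Lop P a + Lop P b := by
  simp only [Lop_eq, map_add]

lemma Lop_sub (P a b : MvPolynomial (Fin 2) ℝ) : Lop P (a - b) = Lop P a - Lop P b := by
  simp only [Lop_eq, map_sub]

lemma Lop_smul (P a : MvPolynomial (Fin 2) ℝ) (c : ℝ) : Lop P (c • a) = c • Lop P a := by
  simp only [Lop_eq, Derivation.map_smul]

lemma Lop_sum (P : MvPolynomial (Fin 2) ℝ) {n : ℕ} (f : Fin n → MvPolynomial (Fin 2) ℝ)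
    (c : Fin n → ℝ) : Lop P (∑ m, c m • f m) = ∑ m, c m • Lop P (f m) := by
  simp only [Lop_eq, map_sum, Derivation.map_smul]

lemma Lop_iter_sum (P : MvPolynomial (Fin 2) ℝ) {n : ℕ} (f : Fin n → MvPolynomial (Fin 2) ℝ)
    (c : Fin n → ℝ) (i : ℕ) :
    (Lop P)^[i] (∑ m, c m • f m) = ∑ m, c m • (Lop P)^[i] (f m) := by
  induction i generalizing f with
  | zero => rfl
  | succ i ih => simp only [Function.iterate_succ, Function.comp, Lop_sum, ih]

lemma evalRR_add (a b : MvPolynomial (Fin 2) ℝ) (p) : evalRR (a + b) p = evalRR a p + evalRR b p := by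
  simp [evalRR]
lemma evalRR_sub (a b : MvPolynomial (Fin 2) ℝ) (p) : evalRR (a - b) p = evalRR a p - evalRR b p := by
  simp [evalRR]
lemma evalRR_mul (a b : MvPolynomial (Fin 2) ℝ) (p) : evalRR (a * b) p = evalRR a p * evalRR b p := by
  simp [evalRR]
lemma evalRR_smul (c : ℝ) (b : MvPolynomial (Fin 2) ℝ) (p) : evalRR (c • b) p = c * evalRR b p := by
  simp [evalRR]
lemma evalRR_sum {n : ℕ} (f : Fin n → MvPolynomial (Fin 2) ℝ) (p) :
    evalRR (∑ m, f m) p = ∑ m, evalRR (f m) p := by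
  simp [evalRR]

/-- Vanishing to order `m` along `L` at `p`. -/
def Van (P : MvPolynomial (Fin 2) ℝ) (p : ℝ × ℝ) (m : ℕ) (F : MvPolynomial (Fin 2) ℝ) : Prop :=
  ∀ i < m, evalRR ((Lop P)^[i] F) p = 0

lemma Van.mono {P p m m' F} (h : Van P p m F) (hm : m' ≤ m) : Van P p m' F :=
  fun i hi => h i (hi.trans_le hm)

lemma van_succ {P p m F} : Van P p (m + 1) F ↔ evalRR F p = 0 ∧ Van P p m (Lop P F) := by
  constructor
  · intro h
    exact ⟨h 0 (by omega), fun i hi => h (i + 1) (by omega)⟩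
  · rintro ⟨h0, h⟩ i hi
    cases i with
    | zero => exact h0
    | succ i => exact h i (by omega)

lemma Lop_iter_add (P a b : MvPolynomial (Fin 2) ℝ) (i : ℕ) :
    (Lop P)^[i] (a + b) = (Lop P)^[i] a + (Lop P)^[i] b := by
  induction i generalizing a b with
  | zero => rfl
  | succ i ih => simp only [Function.iterate_succ, Function.comp, Lop_add, ih]

lemma Lop_iter_sub (P a b : MvPolynomial (Fin 2) ℝ) (i : ℕ) :
    (Lop P)^[i] (a - b) = (Lop P)^[i] a - (Lop P)^[i] b := by
  induction i generalizing a b with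
  | zero => rfl
  | succ i ih => simp only [Function.iterate_succ, Function.comp, Lop_sub, ih]

lemma Van.add {P p m F G} (h : Van P p m F) (h' : Van P p m G) : Van P p m (F + G) := by
  intro i hi
  rw [Lop_iter_add, evalRR_add, h i hi, h' i hi, add_zero]

lemma Van.sub {P p m F G} (h : Van P p m F) (h' : Van P p m G) : Van P p m (F - G) := by
  intro i hi
  rw [Lop_iter_sub, evalRR_sub, h i hi, h' i hi, sub_zero]

lemma Van.mul {P p m F} (h : Van P p m F) (a) : Van P p m (a * F) := by
  induction m generalizing F a with
  | zero => intro i hi; omega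
  | succ m ih =>
    rw [van_succ, Lop_mul, evalRR_mul, (van_succ.1 h).1, mul_zero]
    exact ⟨rfl, (ih (h.mono (by omega)) _).add (ih (van_succ.1 h).2 _)⟩

lemma Van.of_mul {P p m F a} (ha : evalRR a p ≠ 0) (h : Van P p m (a * F)) : Van P p m F := by
  induction m generalizing F with
  | zero => intro i hi; omega
  | succ m ih =>
    have h1 := ih (h.mono (by omega))
    obtain ⟨h2, h3⟩ := van_succ.1 h
    rw [evalRR_mul] at h2
    refine van_succ.2 ⟨(mul_eq_zero.1 h2).resolve_left ha, ih ?_⟩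
    rw [Lop_mul] at h3
    have := h3.sub (h1.mul (Lop P a))
    rwa [add_sub_cancel_left] at this

lemma Van.lift {P p n F a} (ha : evalRR a p ≠ 0) (hF : evalRR F p = 0)
    (h : Van P p n (a * Lop P F - F * Lop P a)) : Van P p (n + 1) F := by
  have key : ∀ m ≤ n, Van P p (m + 1) F := by
    intro m
    induction m with
    | zero =>
      intro _
      exact van_succ.2 ⟨hF, fun i hi => by omega⟩
    | succ m ih =>
      intro hm
      have h1 := ih (by omega)
      have h2 := (h.mono hm).add (h1.mul (Lop P a))
      rw [mul_comm (Lop P a) F, sub_add_cancel] at h2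
      exact van_succ.2 ⟨hF, h2.of_mul ha⟩
  exact key n le_rfl

/-- Nondegeneracy of all partial Wronskians at `p`, in kernel form. -/
def Nondeg (P : MvPolynomial (Fin 2) ℝ) (p : ℝ × ℝ) {n : ℕ}
    (f : Fin n → MvPolynomial (Fin 2) ℝ) : Prop :=
  ∀ (j : ℕ) (hj : j ≤ n) (c : Fin j → ℝ), Van P p j (∑ m, c m • f (Fin.castLE hj m)) → c = 0

lemma Nondeg.zero_ne {P p} {n : ℕ} {f : Fin (n + 1) → MvPolynomial (Fin 2) ℝ}
    (h : Nondeg P p f) : evalRR (f 0) p ≠ 0 := by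
  intro h0
  have := h 1 (by omega) (fun _ => 1) (by
    refine van_succ.2 ⟨?_, fun i hi => by omega⟩
    simpa using h0)
  simpa using congrFun this 0

/-- The reduced system. -/
noncomputable def red (P : MvPolynomial (Fin 2) ℝ) {n : ℕ}
    (f : Fin (n + 1) → MvPolynomial (Fin 2) ℝ) (m : Fin n) : MvPolynomial (Fin 2) ℝ :=
  f 0 * Lop P (f m.succ) - f m.succ * Lop P (f 0)

lemma red_sum (P A : MvPolynomial (Fin 2) ℝ) {j : ℕ} (g : Fin j → MvPolynomial (Fin 2) ℝ)
    (c : Fin j → ℝ) : ∑ m, c m • (A * Lop P (g m) - g m * Lop P A) =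
      A * Lop P (∑ m, c m • g m) - (∑ m, c m • g m) * Lop P A := by
  rw [Lop_sum, Finset.mul_sum, Finset.sum_mul, ← Finset.sum_sub_distrib]
  refine Finset.sum_congr rfl fun m _ => ?_
  rw [smul_sub, mul_smul_comm, smul_mul_assoc]

lemma Nondeg.red {P p} {n : ℕ} {f : Fin (n + 1) → MvPolynomial (Fin 2) ℝ}
    (h : Nondeg P p f) : Nondeg P p (red P f) := by
  intro j hj c hc
  have h0 := h.zero_ne
  set F := ∑ m : Fin j, c m • f (Fin.castLE hj m).succ with hF
  have e1 := red_sum P (f 0) (fun m : Fin j => f (Fin.castLE hj m).succ) c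
  unfold _root_.red at hc
  rw [e1, ← hF] at hc
  set c0 := evalRR F p / evalRR (f 0) p with hc0
  have h1 : Van P p (j + 1) (F - c0 • f 0) := by
    refine Van.lift h0 ?_ (a := f 0) ?_
    · rw [evalRR_sub, evalRR_smul, hc0, div_mul_cancel₀ _ h0, sub_self]
    · convert hc using 1
      rw [Lop_sub, Lop_smul, mul_sub, sub_mul, mul_smul_comm, smul_mul_assoc]
      ring
  have h2 := h (j + 1) (by omega) (Fin.cons (-c0) c) (by
    convert h1 using 1
    rw [Fin.sum_univ_succ]
    simp only [Fin.cons_zero, Fin.cons_succ, neg_smul, Fin.castLE_zero]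
    rw [hF, neg_add_eq_sub]
    rfl)
  funext m
  simpa using congrFun h2 m.succ

theorem polya (P : MvPolynomial (Fin 2) ℝ) (a b : ℝ) (σ : ℝ → ℝ × ℝ)
    (hσ : ∀ t ∈ Set.Ioo a b, ∃ c : ℝ, c ≠ 0 ∧ ∀ F : MvPolynomial (Fin 2) ℝ,
      HasDerivAt (fun s => evalRR F (σ s)) (c * evalRR (Lop P F) (σ t)) t) (n : ℕ) :
    ∀ (f : Fin n → MvPolynomial (Fin 2) ℝ), (∀ t ∈ Set.Ioo a b, Nondeg P (σ t) f) →
      ∀ c : Fin n → ℝ, c ≠ 0 → ∀ T : Finset ℝ, (∀ t ∈ T, t ∈ Set.Ioo a b ∧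
        evalRR (∑ m, c m • f m) (σ t) = 0) → T.card < n := by
  induction n with
  | zero => intro f _ c hc; exact absurd (Subsingleton.elim _ _) hc
  | succ n ih =>
    intro f hf c hc T hT
    have hne : ∀ t ∈ Set.Ioo a b, evalRR (f 0) (σ t) ≠ 0 := fun t ht => (hf t ht).zero_ne
    set F := ∑ m, c m • f m with hF
    have hFs : F = c 0 • f 0 + ∑ m : Fin n, c m.succ • f m.succ := by
      rw [hF, Fin.sum_univ_succ]
    by_cases hc' : (fun m : Fin n => c m.succ) = 0
    · have hz : ∀ m : Fin n, c m.succ = 0 := fun m => congrFun hc' m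
      have h0 : c 0 ≠ 0 := by
        intro h0
        exact hc (funext (Fin.cases h0 hz))
      have : T = ∅ := by
        refine Finset.eq_empty_of_forall_notMem fun t ht => ?_
        obtain ⟨h1, h2⟩ := hT t ht
        rw [hFs] at h2
        simp only [hz, zero_smul, Finset.sum_const_zero, add_zero, evalRR_smul] at h2
        exact (mul_ne_zero h0 (hne t h1)) h2
      simp [this]
    · have ih' := ih (red P f) (fun t ht => (hf t ht).red) _ hc'
      have hG : ∑ m : Fin n, c m.succ • red P f m = f 0 * Lop P F - F * Lop P (f 0) := by
        unfold red
        rw [red_sum P (f 0) (fun m : Fin n => f m.succ), hFs, Lop_add, Lop_smul, mul_add, add_mul,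
          mul_smul_comm, smul_mul_assoc]
        ring
      simp only [hG] at ih'
      set Z : Set ℝ := {t | t ∈ Set.Ioo a b ∧
        evalRR (f 0 * Lop P F - F * Lop P (f 0)) (σ t) = 0} with hZ
      have hZf : Z.Finite := by
        by_contra h
        obtain ⟨T', h1, h2⟩ := Set.Infinite.exists_subset_card_eq h n
        have := ih' T' (fun t ht => h1 ht)
        omega
      have h1 := ih' hZf.toFinset (fun t ht => by simpa [hZ] using ht)
      have h2 : T.card ≤ hZf.toFinset.card + 1 := by
        refine Finset.card_le_of_interleaved fun x hx y hy hxy _ => ?_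
        obtain ⟨hxI, hx0⟩ := hT x hx
        obtain ⟨hyI, hy0⟩ := hT y hy
        have hd : ∀ t ∈ Set.Ioo a b, ∃ c : ℝ, c ≠ 0 ∧
            HasDerivAt (fun s => evalRR F (σ s) / evalRR (f 0) (σ s))
              (c * evalRR (f 0 * Lop P F - F * Lop P (f 0)) (σ t) / evalRR (f 0) (σ t) ^ 2) t := by
          intro t ht
          obtain ⟨c, hc, h⟩ := hσ t ht
          refine ⟨c, hc, ?_⟩
          have hdiv := (h F).div (h (f 0)) (hne t ht)
          have e : c * evalRR (f 0 * Lop P F - F * Lop P (f 0)) (σ t) =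
              c * evalRR (Lop P F) (σ t) * evalRR (f 0) (σ t) -
                evalRR F (σ t) * (c * evalRR (Lop P (f 0)) (σ t)) := by
            rw [evalRR_sub, evalRR_mul, evalRR_mul]
            ring
          rw [e]
          exact hdiv
        have hsub : ∀ t, x ≤ t → t ≤ y → t ∈ Set.Ioo a b :=
          fun t h1 h2 => ⟨hxI.1.trans_le h1, h2.trans_lt hyI.2⟩
        obtain ⟨z, hz, hz'⟩ := exists_deriv_eq_zero (f := fun s => evalRR F (σ s) / evalRR (f 0) (σ s))
          hxy (fun t ht => by
            obtain ⟨_, _, h⟩ := hd t (hsub t ht.1 ht.2)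
            exact h.continuousAt.continuousWithinAt) (by simp [hx0, hy0])
        have hzI := hsub z hz.1.le hz.2.le
        obtain ⟨e, he, h⟩ := hd z hzI
        rw [h.deriv, div_eq_zero_iff, mul_eq_zero] at hz'
        refine ⟨z, ?_, hz.1, hz.2⟩
        simp only [Set.Finite.mem_toFinset, hZ]
        refine ⟨hzI, ?_⟩
        rcases hz' with (h' | h') | h'
        · exact absurd h' he
        · exact h'
        · exact absurd h' (pow_ne_zero 2 (hne z hzI))
      omega

/-- A differentiable section of `h` over an open interval with values in `S`. -/
def Sec (S : Set (ℝ × ℝ)) (h : ℝ × ℝ → ℝ) (σ : ℝ → ℝ × ℝ) (a b : ℝ) : Prop :=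
  ∀ t ∈ Set.Ioo a b, DifferentiableAt ℝ σ t ∧ σ t ∈ S ∧ h (σ t) = t

/-- Local sections exist and cover a neighbourhood. -/
def LocSec (S : Set (ℝ × ℝ)) (h : ℝ × ℝ → ℝ) : Prop :=
  ∀ p ∈ S, ∃ (a b : ℝ) (τ : ℝ → ℝ × ℝ), Sec S h τ a b ∧
    ∀ᶠ q in nhds p, q ∈ S → h q ∈ Set.Ioo a b ∧ τ (h q) = q

lemma Sec.unique {S h σ τ a b} (H : LocSec S h) (hσ : Sec S h σ a b) (hτ : Sec S h τ a b)
    {t₀ : ℝ} (ht₀ : t₀ ∈ Set.Ioo a b) (h0 : σ t₀ = τ t₀) : ∀ t ∈ Set.Ioo a b, σ t = τ t := by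
  intro t ht
  have key := (isPreconnected_Ioo (a := a) (b := b)).induction₂
    (fun x y => (σ x = τ x ↔ σ y = τ y)) ?_ ?_ ?_ ht₀ ht
  · exact key.1 h0
  · intro x hx
    refine Filter.Eventually.filter_mono nhdsWithin_le_nhds ?_
    have c1 := (hσ x hx).1.continuousAt
    have c2 := (hτ x hx).1.continuousAt
    by_cases hxe : σ x = τ x
    · obtain ⟨c, d, ρ, _, hρ⟩ := H (σ x) (hσ x hx).2.1
      have e1 := c1.eventually hρ
      have e2 := c2.eventually (hxe ▸ hρ)
      filter_upwards [e1, e2, isOpen_Ioo.mem_nhds hx] with y h1 h2 hy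
      have a1 := (h1 (hσ y hy).2.1).2
      have a2 := (h2 (hτ y hy).2.1).2
      rw [(hσ y hy).2.2] at a1
      rw [(hτ y hy).2.2] at a2
      simp [hxe, ← a1, ← a2]
    · filter_upwards [(c1.ne_iff_eventually_ne c2).1 hxe] with y hy
      simp [hxe, hy]
  · intro x y z _ _ _ h1 h2; exact h1.trans h2
  · intro x y _ _ h1; exact h1.symm

lemma Sec.glue {S h σ τ a b c d} (H : LocSec S h) (hσ : Sec S h σ a b) (hτ : Sec S h τ c d)
    {t₀ : ℝ} (h1 : t₀ ∈ Set.Ioo a b) (h2 : t₀ ∈ Set.Ioo c d) (h0 : σ t₀ = τ t₀) :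
    ∃ ρ, Sec S h ρ (min a c) (max b d) ∧ (∀ t ∈ Set.Ioo a b, ρ t = σ t) ∧
      ∀ t ∈ Set.Ioo c d, ρ t = τ t := by
  classical
  have hu : ∀ t ∈ Set.Ioo (max a c) (min b d), σ t = τ t := by
    refine Sec.unique H (fun t ht => hσ t ?_) (fun t ht => hτ t ?_) (t₀ := t₀) ?_ h0
    all_goals simp only [Set.mem_Ioo, max_lt_iff, lt_min_iff] at *; tauto
  set ρ : ℝ → ℝ × ℝ := fun t => if t ∈ Set.Ioo a b then σ t else τ t with hρ
  have e1 : ∀ t ∈ Set.Ioo a b, ρ t = σ t := fun t ht => by simp only [hρ]; rw [if_pos ht]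
  have e2 : ∀ t ∈ Set.Ioo c d, ρ t = τ t := fun t ht => by
    by_cases ht' : t ∈ Set.Ioo a b
    · rw [e1 t ht']
      apply hu
      simp only [Set.mem_Ioo, max_lt_iff, lt_min_iff] at *; tauto
    · simp only [hρ]; rw [if_neg ht']
  refine ⟨ρ, fun t ht => ?_, e1, e2⟩
  have : t ∈ Set.Ioo a b ∨ t ∈ Set.Ioo c d := by
    simp only [Set.mem_Ioo, min_lt_iff, lt_max_iff] at *
    rcases lt_trichotomy t t₀ with h | h | h
    · rcases ht.1 with h' | h'
      · left; exact ⟨h', h.trans h1.2⟩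
      · right; exact ⟨h', h.trans h2.2⟩
    · subst h; left; exact h1
    · rcases ht.2 with h' | h'
      · left; exact ⟨h1.1.trans h, h'⟩
      · right; exact ⟨h2.1.trans h, h'⟩
  rcases this with h | h
  · rw [e1 t h]
    refine ⟨(hσ t h).1.congr_of_eventuallyEq ?_, (hσ t h).2⟩
    filter_upwards [isOpen_Ioo.mem_nhds h] with y hy using e1 y hy
  · rw [e2 t h]
    refine ⟨(hτ t h).1.congr_of_eventuallyEq ?_, (hτ t h).2⟩
    filter_upwards [isOpen_Ioo.mem_nhds h] with y hy using e2 y hy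

/-- The section `σ` over `(a,b)` passes through `p`. -/
def Thru (h : ℝ × ℝ → ℝ) (σ : ℝ → ℝ × ℝ) (a b : ℝ) (p : ℝ × ℝ) : Prop :=
  h p ∈ Set.Ioo a b ∧ σ (h p) = p

lemma Sec.glue' {S h σ τ a b c d p} (H : LocSec S h) (hσ : Sec S h σ a b) (hτ : Sec S h τ c d)
    (h1 : Thru h σ a b p) (h2 : Thru h τ c d p) :
    ∃ a' b' ρ, Sec S h ρ a' b' ∧ (∀ q, Thru h σ a b q → Thru h ρ a' b' q) ∧
      ∀ q, Thru h τ c d q → Thru h ρ a' b' q := by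
  obtain ⟨ρ, h3, h4, h5⟩ := hσ.glue H hτ h1.1 h2.1 (h1.2.trans h2.2.symm)
  refine ⟨_, _, ρ, h3, fun q hq => ⟨?_, (h4 _ hq.1).trans hq.2⟩,
    fun q hq => ⟨?_, (h5 _ hq.1).trans hq.2⟩⟩
  · exact ⟨(min_le_left _ _).trans_lt hq.1.1, hq.1.2.trans_le (le_max_left _ _)⟩
  · exact ⟨(min_le_right _ _).trans_lt hq.1.1, hq.1.2.trans_le (le_max_right _ _)⟩

lemma two_points {S C h} (H : LocSec S h) (hC : IsPreconnected C) (hCS : C ⊆ S) {p q : ℝ × ℝ}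
    (hp : p ∈ C) (hq : q ∈ C) : ∃ a b σ, Sec S h σ a b ∧ Thru h σ a b p ∧ Thru h σ a b q := by
  refine hC.induction₂ (fun p q => ∃ a b σ, Sec S h σ a b ∧ Thru h σ a b p ∧ Thru h σ a b q)
    ?_ ?_ ?_ hp hq
  · intro x hx
    obtain ⟨a, b, τ, h1, h2⟩ := H x (hCS hx)
    have h3 := h2.self_of_nhds (hCS hx)
    filter_upwards [h2.filter_mono nhdsWithin_le_nhds, self_mem_nhdsWithin] with y hy hyC
    exact ⟨a, b, τ, h1, h3, hy (hCS hyC)⟩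
  · rintro x y z _ _ _ ⟨a, b, σ, h1, h2, h3⟩ ⟨c, d, τ, h4, h5, h6⟩
    obtain ⟨a', b', ρ, h7, h8, h9⟩ := h1.glue' H h4 h3 h5
    exact ⟨a', b', ρ, h7, h8 _ h2, h9 _ h6⟩
  · rintro x y _ _ ⟨a, b, σ, h1, h2, h3⟩
    exact ⟨a, b, σ, h1, h3, h2⟩

lemma finset_points {S C h} (H : LocSec S h) (hC : IsPreconnected C) (hCS : C ⊆ S) {p : ℝ × ℝ}
    (hp : p ∈ C) (F : Finset (ℝ × ℝ)) (hF : ∀ q ∈ F, q ∈ C) :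
    ∃ a b σ, Sec S h σ a b ∧ Thru h σ a b p ∧ ∀ q ∈ F, Thru h σ a b q := by
  classical
  induction F using Finset.induction_on with
  | empty =>
    obtain ⟨a, b, σ, h1, h2, _⟩ := two_points H hC hCS hp hp
    exact ⟨a, b, σ, h1, h2, by simp⟩
  | insert x F hx ih =>
    obtain ⟨a, b, σ, h1, h2, h3⟩ := ih fun q hq => hF q (Finset.mem_insert_of_mem hq)
    obtain ⟨c, d, τ, h4, h5, h6⟩ := two_points H hC hCS hp (hF x (Finset.mem_insert_self _ _))
    obtain ⟨a', b', ρ, h7, h8, h9⟩ := h1.glue' H h4 h2 h5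
    refine ⟨a', b', ρ, h7, h8 _ h2, fun q hq => ?_⟩
    rcases Finset.mem_insert.1 hq with rfl | hq
    · exact h9 _ h6
    · exact h8 _ (h3 q hq)

noncomputable def dE (F : MvPolynomial (Fin 2) ℝ) (p : ℝ × ℝ) : ℝ × ℝ →L[ℝ] ℝ :=
  evalRR (MvPolynomial.pderiv 0 F) p • ContinuousLinearMap.fst ℝ ℝ ℝ +
    evalRR (MvPolynomial.pderiv 1 F) p • ContinuousLinearMap.snd ℝ ℝ ℝ

lemma dE_apply (F p v) : dE F p v = evalRR (MvPolynomial.pderiv 0 F) p * v.1 +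
    evalRR (MvPolynomial.pderiv 1 F) p * v.2 := by
  simp [dE]

lemma evalRR_X0 (p : ℝ × ℝ) : evalRR (MvPolynomial.X 0) p = p.1 := by simp [evalRR]
lemma evalRR_X1 (p : ℝ × ℝ) : evalRR (MvPolynomial.X 1) p = p.2 := by simp [evalRR]

lemma contDiff_evalRR (F : MvPolynomial (Fin 2) ℝ) {n : WithTop ℕ∞} : ContDiff ℝ n (evalRR F) := by
  induction F using MvPolynomial.induction_on with
  | C a =>
    have : evalRR (MvPolynomial.C a) = fun _ => a := by funext p; simp [evalRR]
    rw [this]; exact contDiff_const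
  | add p q hp hq =>
    have : evalRR (p + q) = fun x => evalRR p x + evalRR q x := by funext x; exact evalRR_add _ _ _
    rw [this]; exact hp.add hq
  | mul_X p i hp =>
    have : evalRR (p * MvPolynomial.X i) = fun x => evalRR p x * evalRR (MvPolynomial.X i) x := by
      funext x; exact evalRR_mul _ _ _
    rw [this]
    refine hp.mul ?_
    fin_cases i
    · have : evalRR (MvPolynomial.X 0) = fun x => x.1 := by funext x; exact evalRR_X0 x
      simp only [Fin.zero_eta, this]; exact contDiff_fst
    · have : evalRR (MvPolynomial.X 1) = fun x => x.2 := by funext x; exact evalRR_X1 x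
      simp only [Fin.mk_one, this]; exact contDiff_snd

lemma hasFDerivAt_evalRR (F : MvPolynomial (Fin 2) ℝ) (p : ℝ × ℝ) :
    HasFDerivAt (evalRR F) (dE F p) p := by
  induction F using MvPolynomial.induction_on with
  | C a =>
    have : evalRR (MvPolynomial.C a) = fun _ => a := by funext p; simp [evalRR]
    rw [this]
    have e : dE (MvPolynomial.C a) p = 0 := by
      ext <;> simp [dE, evalRR]
    rw [e]; exact hasFDerivAt_const _ _
  | add q r hq hr =>
    have : evalRR (q + r) = evalRR q + evalRR r := by funext x; exact evalRR_add _ _ _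
    rw [this]
    have e : dE (q + r) p = dE q p + dE r p := by
      ext <;> simp [dE, evalRR]
    rw [e]; exact hq.add hr
  | mul_X q i hq =>
    have : evalRR (q * MvPolynomial.X i) = evalRR q * evalRR (MvPolynomial.X i) := by
      funext x; exact evalRR_mul _ _ _
    rw [this]
    have hX : HasFDerivAt (evalRR (MvPolynomial.X i)) (dE (MvPolynomial.X i) p) p := by
      fin_cases i
      · have : evalRR (MvPolynomial.X 0) = fun x => x.1 := by funext x; exact evalRR_X0 x
        have e : dE (MvPolynomial.X 0) p = ContinuousLinearMap.fst ℝ ℝ ℝ := by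
          ext <;> simp [dE, evalRR, MvPolynomial.pderiv_X]
        simp only [Fin.zero_eta, this, e]; exact hasFDerivAt_fst
      · have : evalRR (MvPolynomial.X 1) = fun x => x.2 := by funext x; exact evalRR_X1 x
        have e : dE (MvPolynomial.X 1) p = ContinuousLinearMap.snd ℝ ℝ ℝ := by
          ext <;> simp [dE, evalRR, MvPolynomial.pderiv_X]
        simp only [Fin.mk_one, this, e]; exact hasFDerivAt_snd
    have e : dE (q * MvPolynomial.X i) p =
        evalRR q p • dE (MvPolynomial.X i) p + evalRR (MvPolynomial.X i) p • dE q p := by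
      refine ContinuousLinearMap.ext fun v => ?_
      simp only [dE_apply, Derivation.leibniz, smul_eq_mul, evalRR_add, evalRR_mul,
        ContinuousLinearMap.add_apply, ContinuousLinearMap.smul_apply]
      ring
    rw [e]; exact hq.mul hX

lemma isClosed_zero (F : MvPolynomial (Fin 2) ℝ) : IsClosed {p | evalRR F p = 0} :=
  isClosed_eq (contDiff_evalRR F (n := 0)).continuous continuous_const

lemma isClosed_SigmaSet (P : MvPolynomial (Fin 2) ℝ) {μ : ℕ}
    (f : Fin μ → MvPolynomial (Fin 2) ℝ) : IsClosed (SigmaSet P f) := by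
  have : SigmaSet P f = ({p | evalRR (MvPolynomial.pderiv 0 P) p = 0} ∩
      ({p | evalRR (MvPolynomial.pderiv 1 P) p = 0} ∩ {p | evalRR P p = 0})) ∪
      ⋃ j : Fin μ, {p | evalRR (xiWronskian P f (j + 1) (by omega)) p = 0} := by
    ext p
    simp only [SigmaSet, Set.mem_setOf_eq, Set.mem_union, Set.mem_inter_iff, Set.mem_iUnion]
    refine or_congr Iff.rfl ⟨?_, ?_⟩
    · rintro ⟨j, hj, h1, h⟩
      obtain ⟨i, rfl⟩ : ∃ i, j = i + 1 := ⟨j - 1, by omega⟩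
      exact ⟨⟨i, by omega⟩, h⟩
    · rintro ⟨j, h⟩
      exact ⟨j + 1, by omega, by omega, h⟩
  rw [this]
  exact ((isClosed_zero _).inter ((isClosed_zero _).inter (isClosed_zero _))).union
    (isClosed_iUnion_of_finite fun _ => isClosed_zero _)

lemma nondeg_of_notMem {P : MvPolynomial (Fin 2) ℝ} {μ : ℕ}
    {f : Fin μ → MvPolynomial (Fin 2) ℝ} {p : ℝ × ℝ} (hp : p ∉ SigmaSet P f) : Nondeg P p f := by
  intro j hj c hc
  rcases Nat.eq_zero_or_pos j with rfl | hj0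
  · exact Subsingleton.elim _ _
  by_contra hne
  refine hp (Or.inr ⟨j, hj, hj0, ?_⟩)
  have e : evalRR (xiWronskian P f j hj) p = Matrix.det (Matrix.of fun i m : Fin j =>
      evalRR ((Lop P)^[(i : ℕ)] (f (Fin.castLE hj m))) p) := by
    unfold evalRR xiWronskian
    rw [RingHom.map_det]
    rfl
  rw [e, ← Matrix.exists_mulVec_eq_zero_iff]
  refine ⟨c, hne, ?_⟩
  funext i
  have := hc i i.2
  rw [Lop_iter_sum, evalRR_sum] at this
  simp only [evalRR_smul] at this
  simp only [Matrix.mulVec, dotProduct, Matrix.of_apply, Pi.zero_apply]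
  rw [← this]
  exact Finset.sum_congr rfl fun m _ => mul_comm _ _

lemma locSec {P A B : MvPolynomial (Fin 2) ℝ} {Γ Sg : Set (ℝ × ℝ)}
    (hΓ : Γ = {p | evalRR P p = 0}) (hcl : IsClosed Sg)
    (hA : ∀ p, p ∉ Sg → evalRR A p ≠ 0)
    (hW : ∀ p, p ∉ Sg → evalRR (A * Lop P B - B * Lop P A) p ≠ 0) :
    LocSec (Γ \ Sg) (fun p => evalRR B p / evalRR A p) := by
  rintro p ⟨hpΓ, hpS⟩
  have hA0 := hA p hpS
  have hW0 := hW p hpS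
  set h : ℝ × ℝ → ℝ := fun p => evalRR B p / evalRR A p with hh
  set Φ : ℝ × ℝ → ℝ × ℝ := fun q => (h q, evalRR P q) with hΦ
  have hcd : ContDiffAt ℝ 1 Φ p :=
    (((contDiff_evalRR B).contDiffAt).div ((contDiff_evalRR A).contDiffAt) hA0).prodMk
      (contDiff_evalRR P).contDiffAt
  have hfd := (hcd.differentiableAt (by norm_num)).hasFDerivAt
  set D := fderiv ℝ Φ p with hD
  have hinj : ∀ v, D v = 0 → v = 0 := by
    intro v hv
    have h1 : HasFDerivAt (evalRR P) ((ContinuousLinearMap.snd ℝ ℝ ℝ).comp D) p := hfd.snd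
    have h2 : HasFDerivAt h ((ContinuousLinearMap.fst ℝ ℝ ℝ).comp D) p := hfd.fst
    have e1 := h1.unique (hasFDerivAt_evalRR P p)
    have h3 : HasFDerivAt (fun q => h q * evalRR A q) _ p := h2.mul (hasFDerivAt_evalRR A p)
    have h4 : (fun q => h q * evalRR A q) =ᶠ[nhds p] evalRR B := by
      filter_upwards [(contDiff_evalRR A (n := 0)).continuous.continuousAt.eventually_ne hA0] with q hq
      exact div_mul_cancel₀ _ hq
    have e2 := (h3.congr_of_eventuallyEq h4.symm).unique (hasFDerivAt_evalRR B p)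
    have e1 := congrArg (fun l => l v) e1
    have e2 := congrArg (fun l => l v) e2
    simp only [dE_apply, ContinuousLinearMap.comp_apply, hv, map_zero,
      ContinuousLinearMap.add_apply, ContinuousLinearMap.smul_apply, smul_eq_mul, mul_zero,
      add_zero] at e1 e2
    simp only [hh] at e2
    rw [evalRR_sub, evalRR_mul, evalRR_mul, Lop, Lop, evalRR_sub, evalRR_sub, evalRR_mul,
      evalRR_mul, evalRR_mul, evalRR_mul] at hW0
    field_simp at e2
    have k1 : v.1 = 0 := by
      apply (mul_eq_zero.1 (?_ : _ * v.1 = 0)).resolve_left hW0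
      linear_combination (-evalRR (MvPolynomial.pderiv 1 P) p) * e2 - (evalRR A p * evalRR (MvPolynomial.pderiv 1 B) p - evalRR B p * evalRR (MvPolynomial.pderiv 1 A) p) * (-e1)
    have k2 : v.2 = 0 := by
      apply (mul_eq_zero.1 (?_ : _ * v.2 = 0)).resolve_left hW0
      linear_combination (evalRR (MvPolynomial.pderiv 0 P) p) * e2 - (evalRR A p * evalRR (MvPolynomial.pderiv 0 B) p - evalRR B p * evalRR (MvPolynomial.pderiv 0 A) p) * e1
    exact Prod.ext k1 k2
  let D' : (ℝ × ℝ) ≃L[ℝ] (ℝ × ℝ) := (LinearEquiv.ofInjectiveEndo (D : ℝ × ℝ →ₗ[ℝ] ℝ × ℝ)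
    ((injective_iff_map_eq_zero _).2 hinj)).toContinuousLinearEquiv
  have hfd' : HasFDerivAt Φ (D' : ℝ × ℝ →L[ℝ] ℝ × ℝ) p := by
    have : (D' : ℝ × ℝ →L[ℝ] ℝ × ℝ) = D := by
      ext <;> rfl
    rw [this]; exact hfd
  have hst := hcd.hasStrictFDerivAt' hfd' one_ne_zero
  set g := hcd.localInverse hfd' one_ne_zero with hg
  have hgp : g (Φ p) = p := hcd.localInverse_apply_image hfd' one_ne_zero
  have hgc : ContDiffAt ℝ 1 g (Φ p) := hcd.to_localInverse hfd' one_ne_zero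
  have l1 : ∀ᶠ q in nhds p, g (Φ q) = q := hst.eventually_left_inverse
  have l2 : ∀ᶠ y in nhds (Φ p), Φ (g y) = y := hst.eventually_right_inverse
  have l3 : ∀ᶠ y in nhds (Φ p), DifferentiableAt ℝ g y :=
    (hgc.eventually (by simp)).mono fun y hy => hy.differentiableAt (by norm_num)
  have l4 : ∀ᶠ y in nhds (Φ p), g y ∉ Sg := by
    have : ∀ᶠ q in nhds (g (Φ p)), q ∉ Sg := by
      rw [hgp]; exact hcl.isOpen_compl.mem_nhds hpS
    exact hgc.continuousAt.eventually this
  have hP0 : ∀ q ∈ Γ, evalRR P q = 0 := fun q hq => by rw [hΓ] at hq; exact hq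
  have hΦp : Φ p = (h p, 0) := by simp only [hΦ, hP0 p hpΓ]
  have hc : ContinuousAt (fun t : ℝ => (t, (0 : ℝ))) (h p) := by fun_prop
  have l5 : ∀ᶠ t in nhds (h p), Φ (g (t, 0)) = (t, 0) ∧ DifferentiableAt ℝ g (t, 0) ∧
      g (t, 0) ∉ Sg := by
    have := l2.and (l3.and l4)
    rw [hΦp] at this
    exact hc.eventually this
  obtain ⟨ε, hε, hball⟩ := Metric.eventually_nhds_iff_ball.1 l5
  rw [Real.ball_eq_Ioo] at hball
  refine ⟨h p - ε, h p + ε, fun t => g (t, 0), fun t ht => ?_, ?_⟩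
  · obtain ⟨b1, b2, b3⟩ := hball t ht
    refine ⟨?_, ⟨?_, b3⟩, congrArg Prod.fst b1⟩
    · exact b2.comp t (by fun_prop : DifferentiableAt ℝ (fun t : ℝ => (t, (0 : ℝ))) t)
    · rw [hΓ]; exact congrArg Prod.snd b1
  · have hhc : ContinuousAt h p := (hcd.continuousAt).fst
    filter_upwards [l1, hhc.eventually (isOpen_Ioo.mem_nhds
      (⟨by linarith, by linarith⟩ : h p ∈ Set.Ioo (h p - ε) (h p + ε)))] with q q1 q2 q3
    refine ⟨q2, ?_⟩
    have : Φ q = (h q, 0) := by simp only [hΦ, hP0 q q3.1]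
    rw [this] at q1
    exact q1

lemma sec_deriv {P A B : MvPolynomial (Fin 2) ℝ} {S : Set (ℝ × ℝ)}
    (hS : ∀ p ∈ S, evalRR P p = 0 ∧ evalRR A p ≠ 0 ∧
      (evalRR (MvPolynomial.pderiv 0 P) p ≠ 0 ∨ evalRR (MvPolynomial.pderiv 1 P) p ≠ 0))
    {σ : ℝ → ℝ × ℝ} {a b : ℝ} (hσ : Sec S (fun p => evalRR B p / evalRR A p) σ a b) :
    ∀ t ∈ Set.Ioo a b, ∃ c : ℝ, c ≠ 0 ∧ ∀ F : MvPolynomial (Fin 2) ℝ,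
      HasDerivAt (fun s => evalRR F (σ s)) (c * evalRR (Lop P F) (σ t)) t := by
  intro t ht
  obtain ⟨hd, htS, hht⟩ := hσ t ht
  obtain ⟨_, hA0, hgrad⟩ := hS _ htS
  set v := deriv σ t with hv
  have hF : ∀ F : MvPolynomial (Fin 2) ℝ,
      HasDerivAt (fun s => evalRR F (σ s)) (dE F (σ t) v) t := fun F =>
    (hasFDerivAt_evalRR F (σ t)).comp_hasDerivAt t hd.hasDerivAt
  have hI := isOpen_Ioo.mem_nhds ht
  have e1 : dE P (σ t) v = 0 := by
    have : (fun s => evalRR P (σ s)) =ᶠ[nhds t] fun _ => 0 := by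
      filter_upwards [hI] with s hs using (hS _ (hσ s hs).2.1).1
    exact ((hF P).congr_of_eventuallyEq this.symm).unique (hasDerivAt_const t 0)
  have e2 : v ≠ 0 := by
    intro h0
    have : (fun s => evalRR B (σ s)) =ᶠ[nhds t] fun s => s * evalRR A (σ s) := by
      filter_upwards [hI] with s hs
      have h1 := (hσ s hs).2.2
      have h2 := (hS _ (hσ s hs).2.1).2.1
      simp only at h1
      rw [div_eq_iff h2] at h1
      exact h1
    have h3 := ((hF B).congr_of_eventuallyEq this.symm).unique ((hasDerivAt_id t).mul (hF A))
    rw [h0] at h3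
    simp at h3
    exact hA0 h3.symm
  rw [dE_apply] at e1
  set X := evalRR (MvPolynomial.pderiv 0 P) (σ t)
  set Y := evalRR (MvPolynomial.pderiv 1 P) (σ t)
  have hN : X ^ 2 + Y ^ 2 ≠ 0 := by
    rcases hgrad with h | h
    · have := pow_pos (abs_pos.2 h) 2; rw [sq_abs] at this; positivity
    · have := pow_pos (abs_pos.2 h) 2; rw [sq_abs] at this; positivity
  set c := (v.1 * Y - v.2 * X) / (X ^ 2 + Y ^ 2) with hc
  have v1 : v.1 = c * Y := by
    rw [hc]; field_simp; linear_combination X * e1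
  have v2 : v.2 = - c * X := by
    rw [hc]; field_simp; linear_combination Y * e1
  refine ⟨c, ?_, fun F => ?_⟩
  · intro h0
    apply e2
    rw [h0] at v1 v2
    exact Prod.ext (by simpa using v1) (by simpa using v2)
  · have := hF F
    rw [dE_apply, v1, v2] at this
    convert this using 1
    rw [Lop, evalRR_sub, evalRR_mul, evalRR_mul]
    ring

lemma exists_coeffs {k μ : ℕ} {f : Fin μ → MvPolynomial (Fin 2) ℝ} (hf : IsMonomialEnum k f)
    {Q : MvPolynomial (Fin 2) ℝ} (hQ : Q.totalDegree ≤ k) : ∃ c : Fin μ → ℝ, ∑ m, c m • f m = Q := by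
  rw [← Submodule.mem_span_range_iff_exists_fun, hf.2, Q.as_sum]
  refine Submodule.sum_mem _ fun s hs => ?_
  have h1 : s 0 + s 1 ≤ k := by
    have := (MvPolynomial.le_totalDegree hs).trans hQ
    rwa [Finsupp.sum_fintype _ _ (fun _ => rfl), Fin.sum_univ_two] at this
  have h2 : MvPolynomial.monomial s (MvPolynomial.coeff s Q) =
      MvPolynomial.coeff s Q • (MvPolynomial.X 0 ^ s 0 * MvPolynomial.X 1 ^ s 1) := by
    rw [MvPolynomial.monomial_eq, Finsupp.prod_fintype _ _ (fun _ => pow_zero _),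
      Fin.prod_univ_two, MvPolynomial.smul_eq_C_mul]
  rw [h2]
  exact Submodule.smul_mem _ _ (Submodule.subset_span ⟨_, _, h1, rfl⟩)

theorem component_chebyshev_bound
    (P : MvPolynomial (Fin 2) ℝ) (hP : Irreducible P)
    (d : ℕ) (hd : d = P.totalDegree)
    (Γ : Set (ℝ × ℝ)) (hΓ : Γ = {p | evalRR P p = 0})
    (k : ℕ) (hk1 : 1 ≤ k) (hkd : k < d)
    (μ : ℕ) (hμ : μ = (k + 1) * (k + 2) / 2)
    (f : Fin μ → MvPolynomial (Fin 2) ℝ) (hf : IsMonomialEnum k f)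
    (p₀ : ℝ × ℝ) (hp₀ : p₀ ∈ Γ \ SigmaSet P f)
    (Γ₀ : Set (ℝ × ℝ)) (hΓ₀ : Γ₀ = connectedComponentIn (Γ \ SigmaSet P f) p₀) :
    ∀ Q : MvPolynomial (Fin 2) ℝ, Q ≠ 0 → Q.totalDegree ≤ k →
      (Γ₀ ∩ {p | evalRR Q p = 0}).Finite ∧
      (Γ₀ ∩ {p | evalRR Q p = 0}).ncard < μ := by
  intro Q hQ0 hQk
  have hμ3 : 3 ≤ μ := by
    rw [hμ, Nat.le_div_iff_mul_le (by norm_num)]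
    nlinarith
  obtain ⟨n, rfl⟩ : ∃ n, μ = n + 2 := ⟨μ - 2, by omega⟩
  obtain ⟨c, hc⟩ := exists_coeffs hf hQk
  have hc0 : c ≠ 0 := by
    rintro rfl
    simp at hc
    exact hQ0 hc.symm
  have hnd : ∀ p, p ∉ SigmaSet P f → Nondeg P p f := fun p hp => nondeg_of_notMem hp
  have hA : ∀ p, p ∉ SigmaSet P f → evalRR (f 0) p ≠ 0 := fun p hp => (hnd p hp).zero_ne
  have hW : ∀ p, p ∉ SigmaSet P f → evalRR (f 0 * Lop P (f 1) - f 1 * Lop P (f 0)) p ≠ 0 :=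
    fun p hp => (hnd p hp).red.zero_ne
  have H := locSec hΓ (isClosed_SigmaSet P f) hA hW
  have hS : ∀ p ∈ Γ \ SigmaSet P f, evalRR P p = 0 ∧ evalRR (f 0) p ≠ 0 ∧
      (evalRR (MvPolynomial.pderiv 0 P) p ≠ 0 ∨ evalRR (MvPolynomial.pderiv 1 P) p ≠ 0) := by
    rintro p ⟨h1, h2⟩
    rw [hΓ] at h1
    refine ⟨h1, hA p h2, ?_⟩
    by_contra! h3
    exact h2 (Or.inl ⟨h3.1, h3.2, h1⟩)
  have hC : IsPreconnected Γ₀ := hΓ₀ ▸ isPreconnected_connectedComponentIn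
  have hCS : Γ₀ ⊆ Γ \ SigmaSet P f := hΓ₀ ▸ connectedComponentIn_subset _ _
  have hp : p₀ ∈ Γ₀ := hΓ₀ ▸ mem_connectedComponentIn hp₀
  have key : ∀ F : Finset (ℝ × ℝ), (F : Set (ℝ × ℝ)) ⊆ Γ₀ ∩ {p | evalRR Q p = 0} →
      F.card < n + 2 := by
    intro F hF
    obtain ⟨a, b, σ, h1, _, h3⟩ := finset_points H hC hCS hp F fun q hq => (hF hq).1
    have := polya P a b σ (sec_deriv hS h1) (n + 2) f
      (fun t ht => hnd _ (h1 t ht).2.1.2) c hc0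
      (F.image fun p => evalRR (f 1) p / evalRR (f 0) p) (by
        intro t ht
        obtain ⟨q, hq, rfl⟩ := Finset.mem_image.1 ht
        refine ⟨(h3 q hq).1, ?_⟩
        have e := (h3 q hq).2
        simp only at e
        rw [e, hc]
        exact (hF hq).2)
    rwa [Finset.card_image_of_injOn] at this
    intro q hq r hr hqr
    rw [← (h3 q hq).2, ← (h3 r hr).2]
    exact congrArg σ hqr
  have hfin : (Γ₀ ∩ {p | evalRR Q p = 0}).Finite := by
    by_contra h
    obtain ⟨F, h1, h2⟩ := Set.Infinite.exists_subset_card_eq h (n + 2)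
    have := key F h1
    omega
  refine ⟨hfin, ?_⟩
  rw [Set.ncard_eq_toFinset_card _ hfin]
  exact key _ (by simp)
end

section
/- There exist absolute constants c > 0 and e > 0 such that the following holds. Let P ∈ ℝ[x,y] be irreducible of degree d ≥ 2 with P_x ≠ 0 and P_y ≠ 0, let Γ = {(x,y) ∈ ℝ² : P(x,y) = 0}, and let r ≥ 1 be an integer. Then the set Π_r is finite and has at most c·d²·r^e elements. -/
open MvPolynomial Topology

/-- The field `ℝ(x,y)` of rational functions in two variables. -/
abbrev RatFunc2 : Type := FractionRing (MvPolynomial (Fin 2) ℝ)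

/-- The inclusion `ℝ[x,y] → ℝ(x,y)`. -/
noncomputable def toRF : MvPolynomial (Fin 2) ℝ →+* RatFunc2 :=
  algebraMap (MvPolynomial (Fin 2) ℝ) RatFunc2

/-- `p` is an isolated point of the set `S ⊆ ℝ²`. -/
def IsIsolatedIn (p : ℝ × ℝ) (S : Set (ℝ × ℝ)) : Prop :=
  p ∈ S ∧ 𝓝[S \ {p}] p = ⊥

/-- The set `Π_r ⊆ Γ = {P = 0}`: points of `Γ` that are isolated zeros on `Γ` of one of
the polynomials `P_x, P_y, P_x ± P_y, x ± 1, y ± 1`, or `y_{xj}, x_{yj}` for `j = 0, …, r`. -/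
def PiSet (P : MvPolynomial (Fin 2) ℝ) (r : ℕ)
    (yx xy : ℕ → MvPolynomial (Fin 2) ℝ) : Set (ℝ × ℝ) :=
  {p | evalRR P p = 0 ∧ ∃ g : MvPolynomial (Fin 2) ℝ,
    (g = pderiv 0 P ∨ g = pderiv 1 P ∨
      g = pderiv 0 P + pderiv 1 P ∨ g = pderiv 0 P - pderiv 1 P ∨
      g = X 0 + 1 ∨ g = X 0 - 1 ∨ g = X 1 + 1 ∨ g = X 1 - 1 ∨
      ∃ j ≤ r, g = yx j ∨ g = xy j) ∧
    IsIsolatedIn p ({q | evalRR g q = 0} ∩ {q | evalRR P q = 0})}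

abbrev R2 : Type := MvPolynomial (Fin 2) ℝ

lemma evalRR_hasDerivAt (Q : R2) (x y : ℝ) :
    HasDerivAt (fun t => evalRR Q (t, y)) (evalRR (pderiv 0 Q) (x, y)) x := by
  unfold evalRR
  induction Q using MvPolynomial.induction_on with
  | C a => simpa using hasDerivAt_const x a
  | add p q hp hq => simpa using hp.fun_add hq
  | mul_X p i hp =>
    fin_cases i
    · have := hp.fun_mul (hasDerivAt_id x)
      simp [Derivation.leibniz, pderiv_X] at this ⊢
      exact this.congr_deriv (by ring)
    · have := hp.mul_const y
      simp [Derivation.leibniz, pderiv_X] at this ⊢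
      exact this.congr_deriv (by ring)

lemma evalRR_continuous (Q : R2) : Continuous (evalRR Q) := by
  unfold evalRR
  induction Q using MvPolynomial.induction_on with
  | C a => simpa using continuous_const
  | add p q hp hq => simpa using hp.fun_add hq
  | mul_X p i hp =>
    fin_cases i
    · simpa using hp.fun_mul continuous_fst
    · simpa using hp.fun_mul continuous_snd

lemma pderiv_zero_of_isolated (P : R2) (p : ℝ × ℝ)
    (h : IsIsolatedIn p {q | evalRR P q = 0}) : evalRR (pderiv 0 P) p = 0 := by
  obtain ⟨x, y⟩ := p
  obtain ⟨h0, h1⟩ := h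
  have h0 : evalRR P (x, y) = 0 := h0
  by_contra hne
  have hd := evalRR_hasDerivAt P x y
  have hmax : ¬ IsLocalMax (fun t => evalRR P (t, y)) x := fun hm =>
    hne (hm.hasDerivAt_eq_zero hd)
  have hmin : ¬ IsLocalMin (fun t => evalRR P (t, y)) x := fun hm =>
    hne (hm.hasDerivAt_eq_zero hd)
  have hU : ∀ᶠ q in 𝓝 (x, y), ¬ (q ∈ {q | evalRR P q = 0} \ {(x, y)}) := by
    rw [← Filter.empty_mem_iff_bot, mem_nhdsWithin_iff_eventually] at h1
    exact h1.mono fun q hq hq' => hq hq'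
  obtain ⟨ε, hε, hb⟩ := Metric.eventually_nhds_iff.1 hU
  rw [IsLocalMax, IsMaxFilter, Filter.not_eventually] at hmax
  rw [IsLocalMin, IsMinFilter, Filter.not_eventually] at hmin
  have hball : ∀ᶠ t in 𝓝 x, dist t x < ε := Metric.eventually_nhds_iff.2 ⟨ε, hε, fun _ h => h⟩
  obtain ⟨t, ht, htb⟩ := (hmax.and_eventually hball).exists
  obtain ⟨s, hs, hsb⟩ := (hmin.and_eventually hball).exists
  simp only [not_le, h0] at ht hs
  have c1 : ∀ u, Continuous fun v => evalRR P (u, v) := fun u =>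
    (evalRR_continuous P).comp (by fun_prop)
  have c2 : ∀ v, Continuous fun u => evalRR P (u, v) := fun v =>
    (evalRR_continuous P).comp (by fun_prop)
  have e1 : ∀ᶠ v in 𝓝 y, 0 < evalRR P (t, v) := (c1 t).continuousAt.eventually (lt_mem_nhds ht)
  have e2 : ∀ᶠ v in 𝓝 y, evalRR P (s, v) < 0 := (c1 s).continuousAt.eventually (gt_mem_nhds hs)
  have e3 : ∀ᶠ v in 𝓝 y, dist v y < ε := Metric.eventually_nhds_iff.2 ⟨ε, hε, fun _ h => h⟩
  have e4 : ∀ᶠ v in 𝓝[≠] y, v ≠ y := eventually_mem_nhdsWithin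
  obtain ⟨v, ⟨⟨hv1, hv2⟩, hv3⟩, hv4⟩ :=
    ((((e1.and e2).and e3).filter_mono nhdsWithin_le_nhds).and e4).exists
  obtain ⟨u, hu, hu0⟩ := intermediate_value_uIcc (c2 v).continuousOn
    (show (0:ℝ) ∈ Set.uIcc (evalRR P (s, v)) (evalRR P (t, v)) by
      rw [Set.uIcc_of_le (hv2.trans hv1).le]; exact ⟨hv2.le, hv1.le⟩)
  have hux : dist u x < ε := by
    have : u ∈ Metric.ball x ε :=
      (convex_ball x ε).ordConnected.uIcc_subset hsb htb hu
    exact this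
  refine hb (y := (u, v)) ?_ ⟨hu0, ?_⟩
  · rw [Prod.dist_eq]; exact max_lt hux hv3
  · intro h; exact hv4 (Prod.ext_iff.1 h).2

lemma totalDegree_pderiv_le (i : Fin 2) (Q : R2) :
    (pderiv i Q).totalDegree ≤ Q.totalDegree - 1 := by
  rw [totalDegree, Finset.sup_le_iff]
  intro m hm
  have h1 : m + Finsupp.single i 1 ∈ Q.support := by
    rw [mem_support_iff] at hm ⊢
    rw [coeff_pderiv] at hm
    exact left_ne_zero_of_mul hm
  have h2 := le_totalDegree h1
  rw [Finsupp.sum_add_index' (by simp) (by simp), Finsupp.sum_single_index rfl] at h2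
  omega

lemma not_dvd_pderiv {P : R2} (i : Fin 2) (hd : 2 ≤ P.totalDegree) (h : pderiv i P ≠ 0) :
    ¬ P ∣ pderiv i P := by
  intro hdvd
  have := totalDegree_le_of_dvd_of_isDomain hdvd h
  have := totalDegree_pderiv_le i P
  omega

lemma finrank_V (k : ℕ) :
    2 * Module.finrank ℝ (restrictTotalDegree (Fin 2) ℝ k) = (k + 1) * (k + 2) := by
  have : Module.finrank ℝ (restrictTotalDegree (Fin 2) ℝ k) =
      ∑ i ∈ Finset.range (k+1), (i+1) := by
    unfold restrictTotalDegree
    rw [Module.finrank_eq_nat_card_basis (basisRestrictSupport ℝ _)]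
    have e : {n : Fin 2 →₀ ℕ | (n.sum fun _ e => e) ≤ k} ≃
        ((Finset.range (k+1)).sigma fun i => Finset.range (i+1)) :=
      { toFun := fun n => ⟨⟨n.1 0 + n.1 1, n.1 0⟩, by
          have := n.2
          simp [Finsupp.sum_fintype] at this
          simp; omega⟩
        invFun := fun s => ⟨Finsupp.equivFunOnFinite.symm ![s.1.2, s.1.1 - s.1.2], by
          have := Finset.mem_sigma.1 s.2
          simp only [Finset.mem_range] at this
          simp [Finsupp.sum_fintype]; omega⟩
        left_inv := by
          rintro ⟨n, hn⟩
          ext i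
          fin_cases i <;> simp
        right_inv := by
          rintro ⟨⟨a, b⟩, hs⟩
          simp at hs
          have : b + (a - b) = a := by omega
          simp [this] }
    rw [Nat.card_congr e, Nat.card_eq_fintype_card, Fintype.card_coe, Finset.card_sigma]
    simp
  rw [this]
  clear this
  induction k with
  | zero => simp
  | succ k ih => rw [Finset.sum_range_succ, mul_add, ih]; ring

lemma ev_surj (S : Finset (ℝ × ℝ)) (k : ℕ) (hk : S.card ≤ k) (f : S → ℝ) :
    ∃ A : R2, A.totalDegree ≤ k ∧ ∀ p : S, evalRR A p = f p := by
  classical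
  let ℓ : ℝ × ℝ → ℝ × ℝ → R2 := fun p q =>
    C (p.1 - q.1) * (X 0 - C q.1) + C (p.2 - q.2) * (X 1 - C q.2)
  have hdeg : ∀ p q, (ℓ p q).totalDegree ≤ 1 := by
    intro p q
    refine (totalDegree_add _ _).trans (max_le ?_ ?_) <;>
    · refine (totalDegree_mul _ _).trans ?_
      rw [totalDegree_C, zero_add]
      refine (totalDegree_sub _ _).trans ?_
      simp
  have hself : ∀ p q, evalRR (ℓ p q) q = 0 := by
    intro p q; simp [ℓ, evalRR]
  have hne : ∀ p q, p ≠ q → evalRR (ℓ p q) p ≠ 0 := by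
    intro p q hpq h
    apply hpq
    have h' : (p.1 - q.1) * (p.1 - q.1) + (p.2 - q.2) * (p.2 - q.2) = 0 := by
      simpa [ℓ, evalRR] using h
    have h1 : p.1 - q.1 = 0 := by nlinarith [mul_self_nonneg (p.1 - q.1), mul_self_nonneg (p.2 - q.2)]
    have h2 : p.2 - q.2 = 0 := by nlinarith [mul_self_nonneg (p.1 - q.1), mul_self_nonneg (p.2 - q.2)]
    exact Prod.ext (by linarith) (by linarith)
  let L : ℝ × ℝ → R2 := fun p => ∏ q ∈ S.erase p, ℓ p q
  have hL0 : ∀ p q, q ∈ S → q ≠ p → evalRR (L p) q = 0 := by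
    intro p q hq hqp
    simp only [L, evalRR, map_prod]
    exact Finset.prod_eq_zero (Finset.mem_erase.2 ⟨hqp, hq⟩) (hself p q)
  have hL1 : ∀ p, evalRR (L p) p ≠ 0 := by
    intro p
    simp only [L, evalRR, map_prod]
    exact Finset.prod_ne_zero_iff.2 fun q hq => hne p q (Finset.ne_of_mem_erase hq).symm
  have hLd : ∀ p, (L p).totalDegree ≤ k := by
    intro p
    refine (totalDegree_finsetProd _ _).trans ((Finset.sum_le_card_nsmul _ _ 1 fun q _ => hdeg p q).trans ?_)
    have := Finset.card_erase_le (s := S) (a := p)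
    simp only [smul_eq_mul, mul_one]; omega
  refine ⟨∑ p : S, C (f p / evalRR (L p) p) * L p, ?_, ?_⟩
  · refine totalDegree_finsetSum_le fun p _ => ?_
    refine (totalDegree_mul _ _).trans ?_
    rw [totalDegree_C, zero_add]; exact hLd p
  · intro p
    have : evalRR (∑ p : S, C (f p / evalRR (L p) p) * L p) p =
        ∑ q : S, (f q / evalRR (L q) q) * evalRR (L q) p := by
      simp [evalRR]
    rw [this, Finset.sum_eq_single p]
    · exact div_mul_cancel₀ _ (hL1 p)
    · intro q _ hqp
      rw [hL0 q p p.2 (fun h => hqp (Subtype.ext h.symm)), mul_zero]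
    · simp

lemma bezout_finset (P Q : R2) (hP : Irreducible P) (hPQ : ¬ P ∣ Q) (n : ℕ)
    (hn : Q.totalDegree ≤ n) (S : Finset (ℝ × ℝ))
    (hS : ∀ p ∈ S, evalRR P p = 0 ∧ evalRR Q p = 0) : S.card ≤ P.totalDegree * n := by
  set m := P.totalDegree with hm
  set N := S.card with hN
  let V := fun k => restrictTotalDegree (Fin 2) ℝ k
  let ev : V (m + n + N) →ₗ[ℝ] (S → ℝ) :=
    { toFun := fun A p => evalRR A.1 p
      map_add' := by intro A B; ext p; simp [evalRR]
      map_smul' := by intro c A; ext p; simp [evalRR, smul_eval] }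
  have hev : Function.Surjective ev := by
    intro f
    obtain ⟨A, hA, hAf⟩ := ev_surj S (m + n + N) (by omega) f
    exact ⟨⟨A, (mem_restrictTotalDegree _ _ _).2 hA⟩, funext hAf⟩
  let φ : (V (n + N) × V (m + N)) →ₗ[ℝ] V (m + n + N) :=
    { toFun := fun A => ⟨A.1.1 * P + A.2.1 * Q, by
        have h1 := (mem_restrictTotalDegree _ _ _).1 A.1.2
        have h2 := (mem_restrictTotalDegree _ _ _).1 A.2.2
        have h3 := totalDegree_mul A.1.1 P
        have h4 := totalDegree_mul A.2.1 Q
        exact (mem_restrictTotalDegree _ _ _).2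
          ((totalDegree_add _ _).trans (max_le (by omega) (by omega)))⟩
      map_add' := by intro A B; ext1; simp; ring
      map_smul' := by intro c A; ext1; simp [smul_add] }
  let ψ : V N →ₗ[ℝ] (V (n + N) × V (m + N)) :=
    { toFun := fun A => (⟨-(Q * A.1), by
        have h1 := (mem_restrictTotalDegree _ _ _).1 A.2
        have h3 := totalDegree_mul Q A.1
        rw [← totalDegree_neg] at h3
        exact (mem_restrictTotalDegree _ _ _).2 (by omega)⟩, ⟨P * A.1, by
        have h1 := (mem_restrictTotalDegree _ _ _).1 A.2
        have h3 := totalDegree_mul P A.1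
        exact (mem_restrictTotalDegree _ _ _).2 (by omega)⟩)
      map_add' := by intro A B; ext1 <;> ext1 <;> simp <;> ring
      map_smul' := by intro c A; ext1 <;> ext1 <;> simp }
  have hker : LinearMap.ker φ ≤ LinearMap.range ψ := by
    rintro ⟨⟨A, hA⟩, ⟨B, hB⟩⟩ h
    have h : A * P + B * Q = 0 := congrArg Subtype.val (LinearMap.mem_ker.1 h)
    have hdvd : P ∣ B * Q := ⟨-A, by linear_combination h⟩
    obtain ⟨D, rfl⟩ := (hP.prime.dvd_or_dvd hdvd).resolve_right hPQ
    have hA' : A = -(Q * D) := by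
      apply mul_right_cancel₀ hP.ne_zero
      linear_combination h
    have hD : D.totalDegree ≤ N := by
      rcases eq_or_ne D 0 with rfl | hD
      · simp
      · have h1 := (mem_restrictTotalDegree _ _ _).1 hB
        rw [totalDegree_mul_of_isDomain hP.ne_zero hD] at h1
        omega
    refine ⟨⟨D, (mem_restrictTotalDegree _ _ _).2 hD⟩, ?_⟩
    subst hA'
    rfl
  have hle : LinearMap.range φ ≤ LinearMap.ker ev := by
    rintro _ ⟨A, rfl⟩
    rw [LinearMap.mem_ker]
    ext p
    have := hS p p.2
    change evalRR (A.1.1 * P + A.2.1 * Q) p = 0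
    simp only [evalRR, map_add, map_mul] at this ⊢
    rw [this.1, this.2]; simp
  have : ∀ k, FiniteDimensional ℝ (V k) := fun k => by
    apply FiniteDimensional.of_finrank_pos
    have := finrank_V k
    have h2 : 0 < (k + 1) * (k + 2) := by positivity
    simp only [V]; omega
  have r1 := LinearMap.finrank_range_add_finrank_ker ev
  have r2 := LinearMap.finrank_range_add_finrank_ker φ
  have r3 := Submodule.finrank_mono hker
  have r4 := Submodule.finrank_mono hle
  have r5 := LinearMap.finrank_range_le ψ
  rw [LinearMap.range_eq_top.2 hev, finrank_top, Module.finrank_fintype_fun_eq_card,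
    Fintype.card_coe] at r1
  rw [Module.finrank_prod] at r2
  have d1 := finrank_V (m + n + N)
  have d2 := finrank_V (n + N)
  have d3 := finrank_V (m + N)
  have d4 := finrank_V N
  simp only [V] at r1 r2 r3 r4 r5
  nlinarith

lemma bezout (P Q : R2) (hP : Irreducible P) (hPQ : ¬ P ∣ Q) (n : ℕ)
    (hn : Q.totalDegree ≤ n) :
    {p | evalRR Q p = 0 ∧ evalRR P p = 0}.Finite ∧
      {p | evalRR Q p = 0 ∧ evalRR P p = 0}.ncard ≤ P.totalDegree * n := by
  have key : ∀ S : Finset (ℝ × ℝ), (S : Set (ℝ × ℝ)) ⊆ {p | evalRR Q p = 0 ∧ evalRR P p = 0} →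
      S.card ≤ P.totalDegree * n := fun S hS =>
    bezout_finset P Q hP hPQ n hn S fun p hp => (hS hp).symm
  have hfin : {p | evalRR Q p = 0 ∧ evalRR P p = 0}.Finite := by
    by_contra h
    obtain ⟨t, ht, hc⟩ := Set.Infinite.exists_subset_card_eq h (P.totalDegree * n + 1)
    have := key t ht
    omega
  refine ⟨hfin, ?_⟩
  rw [Set.ncard_eq_toFinset_card _ hfin]
  exact key _ (by simp)

lemma isolated_bound (P g : R2) (hP : Irreducible P) (hd : 2 ≤ P.totalDegree)
    (hx : pderiv 0 P ≠ 0) (n : ℕ) (hn : g.totalDegree ≤ n) (hdn : P.totalDegree ≤ n) :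
    {p | IsIsolatedIn p ({q | evalRR g q = 0} ∩ {q | evalRR P q = 0})}.Finite ∧
    {p | IsIsolatedIn p ({q | evalRR g q = 0} ∩ {q | evalRR P q = 0})}.ncard
      ≤ P.totalDegree * n := by
  by_cases h : P ∣ g
  · obtain ⟨D, rfl⟩ := h
    have hb := bezout P (pderiv 0 P) hP (not_dvd_pderiv 0 hd hx) n
      ((totalDegree_pderiv_le 0 P).trans (by omega))
    have hsub : {p | IsIsolatedIn p ({q | evalRR (P * D) q = 0} ∩ {q | evalRR P q = 0})} ⊆
        {p | evalRR (pderiv 0 P) p = 0 ∧ evalRR P p = 0} := by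
      intro p hp
      have : ({q | evalRR (P * D) q = 0} ∩ {q | evalRR P q = 0}) = {q | evalRR P q = 0} := by
        apply Set.inter_eq_right.2
        intro q hq
        have hq : eval ![q.1, q.2] P = 0 := hq
        simp [evalRR, hq]
      rw [this] at hp
      exact ⟨pderiv_zero_of_isolated P p hp, hp.1⟩
    exact ⟨hb.1.subset hsub, (Set.ncard_le_ncard hsub hb.1).trans hb.2⟩
  · have hb := bezout P g hP h n hn
    have hsub : {p | IsIsolatedIn p ({q | evalRR g q = 0} ∩ {q | evalRR P q = 0})} ⊆
        {p | evalRR g p = 0 ∧ evalRR P p = 0} := fun p hp => hp.1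
    exact ⟨hb.1.subset hsub, (Set.ncard_le_ncard hsub hb.1).trans hb.2⟩

lemma toRF_injective : Function.Injective toRF :=
  IsFractionRing.injective (MvPolynomial (Fin 2) ℝ) RatFunc2

lemma deg_bound (P : R2) (hd : 2 ≤ P.totalDegree) (i k : Fin 2) (hk : pderiv k P ≠ 0)
    (D : RatFunc2 → RatFunc2)
    (hmul : ∀ a b, D (a * b) = a * D b + D a * b)
    (hD : ∀ q : R2, D (toRF q) = toRF (pderiv i q) -
            (toRF (pderiv i P) / toRF (pderiv k P)) * toRF (pderiv k q))
    (y : ℕ → R2) (hy0 : y 0 = X k)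
    (hy : ∀ j : ℕ, 1 ≤ j →
          toRF (y j) = (toRF (pderiv k P)) ^ (2 * j - 1) * D^[j] (toRF (X k))) (j : ℕ) :
    (y j).totalDegree ≤ 2 * P.totalDegree * (j + 1) := by
  have hb : toRF (pderiv k P) ≠ 0 := fun h => hk (toRF_injective (by rw [h, map_zero]))
  have hpow : ∀ (b : RatFunc2) (n : ℕ), b * D (b ^ (n + 1)) = (n + 1) * b ^ (n + 1) * D b := by
    intro b n
    induction n with
    | zero => simp
    | succ n ih =>
      rw [pow_succ b (n+1), hmul, mul_add, ← mul_assoc b (D _) b, ih]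
      push_cast; ring
  have hbD : ∀ q : R2, toRF (pderiv k P) * D (toRF q) =
      toRF (pderiv k P * pderiv i q - pderiv i P * pderiv k q) := by
    intro q
    rw [hD, map_sub, map_mul, map_mul]
    field_simp
  have dE : ∀ q : R2, (pderiv k P * pderiv i q - pderiv i P * pderiv k q).totalDegree ≤
      (P.totalDegree - 1) + (q.totalDegree - 1) := by
    intro q
    have a1 := totalDegree_pderiv_le k P
    have a2 := totalDegree_pderiv_le i P
    have a3 := totalDegree_pderiv_le k q
    have a4 := totalDegree_pderiv_le i q
    have a5 := totalDegree_mul (pderiv k P) (pderiv i q)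
    have a6 := totalDegree_mul (pderiv i P) (pderiv k q)
    exact (totalDegree_sub _ _).trans (max_le (by omega) (by omega))
  induction j with
  | zero => rw [hy0, totalDegree_X]; omega
  | succ j ih =>
    rcases Nat.eq_zero_or_pos j with rfl | hj
    · have : y 1 = pderiv k P * pderiv i (X k) - pderiv i P * pderiv k (X k) := by
        apply toRF_injective
        rw [hy 1 le_rfl, ← hbD]
        simp
      have h2 := dE (X k)
      rw [← this, totalDegree_X] at h2
      simp only [zero_add]; omega
    · have hrec : y (j + 1) =
          pderiv k P * (pderiv k P * pderiv i (y j) - pderiv i P * pderiv k (y j)) -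
          C (2 * j - 1 : ℝ) * ((pderiv k P * pderiv i (pderiv k P) - pderiv i P * pderiv k (pderiv k P)) * y j) := by
        apply toRF_injective
        obtain ⟨l, rfl⟩ : ∃ l, j = l + 1 := ⟨j - 1, by omega⟩
        have hC : toRF (C (2 * ((l + 1 : ℕ) : ℝ) - 1)) = (2 * l : ℕ) + 1 := by
          have : (C (2 * ((l + 1 : ℕ) : ℝ) - 1) : R2) = ((2 * l + 1 : ℕ) : R2) := by
            rw [← map_natCast (C : ℝ →+* R2)]
            congr 1; push_cast; ring
          rw [this, map_natCast]; push_cast; ring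
        rw [map_sub, map_mul, map_mul toRF (C _), map_mul, ← hbD, ← hbD, hC, hy _ (by omega), hy _ hj,
          hmul, Function.iterate_succ_apply']
        have e1 : 2 * (l + 1 + 1) - 1 = 2 * l + 3 := by omega
        have e2 : 2 * (l + 1) - 1 = 2 * l + 1 := by omega
        rw [e1, e2]
        have := hpow (toRF (pderiv k P)) (2 * l)
        linear_combination (-(toRF (pderiv k P)) * D^[l + 1] (toRF (X k))) * this
      have h1 := dE (y j)
      have h2 := dE (pderiv k P)
      have h3 := totalDegree_pderiv_le k P
      have h4 := totalDegree_mul (pderiv k P) (pderiv k P * pderiv i (y j) - pderiv i P * pderiv k (y j))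
      have h5 := totalDegree_mul (pderiv k P * pderiv i (pderiv k P) - pderiv i P * pderiv k (pderiv k P)) (y j)
      have h6 := totalDegree_mul (C (2 * j - 1 : ℝ)) ((pderiv k P * pderiv i (pderiv k P) - pderiv i P * pderiv k (pderiv k P)) * y j)
      rw [totalDegree_C] at h6
      have h7 : (y (j+1)).totalDegree ≤ (y j).totalDegree + 2 * P.totalDegree := by
        rw [hrec]
        exact (totalDegree_sub _ _).trans (max_le (by omega) (by omega))
      calc _ ≤ _ := h7
        _ ≤ 2 * P.totalDegree * (j + 1) + 2 * P.totalDegree := by omega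
        _ = _ := by ring

theorem PiSet_finite :
    ∃ c e : ℝ, 0 < c ∧ 0 < e ∧
      ∀ (P : MvPolynomial (Fin 2) ℝ), Irreducible P →
      ∀ d : ℕ, d = P.totalDegree → 2 ≤ d →
      pderiv 0 P ≠ 0 → pderiv 1 P ≠ 0 →
      ∀ r : ℕ, 1 ≤ r →
      ∀ Dx Dy : RatFunc2 → RatFunc2,
        (∀ a b, Dx (a + b) = Dx a + Dx b) →
        (∀ a b, Dx (a * b) = a * Dx b + Dx a * b) →
        (∀ a b, Dy (a + b) = Dy a + Dy b) →
        (∀ a b, Dy (a * b) = a * Dy b + Dy a * b) →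
        (∀ q : MvPolynomial (Fin 2) ℝ,
          Dx (toRF q) = toRF (pderiv 0 q) -
            (toRF (pderiv 0 P) / toRF (pderiv 1 P)) * toRF (pderiv 1 q)) →
        (∀ q : MvPolynomial (Fin 2) ℝ,
          Dy (toRF q) = toRF (pderiv 1 q) -
            (toRF (pderiv 1 P) / toRF (pderiv 0 P)) * toRF (pderiv 0 q)) →
      ∀ yx xy : ℕ → MvPolynomial (Fin 2) ℝ,
        yx 0 = X 1 → xy 0 = X 0 →
        (∀ j : ℕ, 1 ≤ j →
          toRF (yx j) = (toRF (pderiv 1 P)) ^ (2 * j - 1) * Dx^[j] (toRF (X 1))) →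
        (∀ j : ℕ, 1 ≤ j →
          toRF (xy j) = (toRF (pderiv 0 P)) ^ (2 * j - 1) * Dy^[j] (toRF (X 0))) →
        (PiSet P r yx xy).Finite ∧
        ((PiSet P r yx xy).ncard : ℝ) ≤ c * (d : ℝ) ^ 2 * (r : ℝ) ^ e := by
  classical
  refine ⟨48, 2, by norm_num, by norm_num, ?_⟩
  intro P hP d hd h2 hPx hPy r hr Dx Dy _ hDxm _ hDym hDx hDy yx xy hyx0 hxy0 hyx hxy
  subst hd
  set d := P.totalDegree with hd
  have dyx := deg_bound P h2 0 1 hPy Dx hDxm hDx yx hyx0 hyx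
  have dxy := deg_bound P h2 1 0 hPx Dy hDym hDy xy hxy0 hxy
  let L : List R2 := [pderiv 0 P, pderiv 1 P, pderiv 0 P + pderiv 1 P, pderiv 0 P - pderiv 1 P,
    X 0 + 1, X 0 - 1, X 1 + 1, X 1 - 1]
  let G : Finset R2 := L.toFinset ∪ ((Finset.range (r + 1)).image yx ∪
    (Finset.range (r + 1)).image xy)
  have hGcard : G.card ≤ 12 * r := by
    have a1 := Finset.card_union_le L.toFinset ((Finset.range (r + 1)).image yx ∪
      (Finset.range (r + 1)).image xy)
    have a2 := Finset.card_union_le ((Finset.range (r + 1)).image yx)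
      ((Finset.range (r + 1)).image xy)
    have a3 := Finset.card_image_le (s := Finset.range (r + 1)) (f := yx)
    have a4 := Finset.card_image_le (s := Finset.range (r + 1)) (f := xy)
    have a5 := L.toFinset_card_le
    have a6 : L.length = 8 := rfl
    rw [Finset.card_range] at a3 a4
    simp only [G]
    omega
  have hdr : d ≤ 4 * d * r := by nlinarith
  have p0 := totalDegree_pderiv_le 0 P
  have p1 := totalDegree_pderiv_le 1 P
  have hGdeg : ∀ g ∈ G, g.totalDegree ≤ 4 * d * r := by
    have hj : ∀ j, j < r + 1 → 2 * d * (j + 1) ≤ 4 * d * r := by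
      intro j hj
      calc 2 * d * (j + 1) ≤ 2 * d * (2 * r) := Nat.mul_le_mul_left _ (by omega)
        _ = 4 * d * r := by ring
    have hX : ∀ i : Fin 2, (X i : R2).totalDegree = 1 := fun i => totalDegree_X i
    intro g hg
    simp only [G, L, Finset.mem_union, List.mem_toFinset, List.mem_cons, List.not_mem_nil, or_false,
      Finset.mem_image, Finset.mem_range] at hg
    have s1 : ∀ i : Fin 2, (X i + 1 : R2).totalDegree ≤ d := fun i =>
      (totalDegree_add _ _).trans (max_le (by rw [hX]; omega) (by simp))
    have s2 : ∀ i : Fin 2, (X i - 1 : R2).totalDegree ≤ d := fun i =>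
      (totalDegree_sub _ _).trans (max_le (by rw [hX]; omega) (by simp))
    rcases hg with (h | h | h | h | h | h | h | h) | ⟨j, hjr, rfl⟩ | ⟨j, hjr, rfl⟩
    · subst h; omega
    · subst h; omega
    · subst h; exact (totalDegree_add _ _).trans (max_le (by omega) (by omega))
    · subst h; exact (totalDegree_sub _ _).trans (max_le (by omega) (by omega))
    · subst h; exact (s1 0).trans hdr
    · subst h; exact (s2 0).trans hdr
    · subst h; exact (s1 1).trans hdr
    · subst h; exact (s2 1).trans hdr
    · exact (dyx j).trans (hj j hjr)
    · exact (dxy j).trans (hj j hjr)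
  let Z : R2 → Set (ℝ × ℝ) := fun g =>
    {p | IsIsolatedIn p ({q | evalRR g q = 0} ∩ {q | evalRR P q = 0})}
  have hZ : ∀ g ∈ G, (Z g).Finite ∧ (Z g).ncard ≤ d * (4 * d * r) := fun g hg =>
    isolated_bound P g hP h2 hPx _ (hGdeg g hg) hdr
  have hsub : PiSet P r yx xy ⊆ ⋃ g ∈ G, Z g := by
    rintro p ⟨_, g, hg, hiso⟩
    refine Set.mem_biUnion (x := g) ?_ hiso
    simp only [G, L, Finset.coe_union, Set.mem_union, Finset.mem_coe, List.mem_toFinset,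
      List.mem_cons, List.not_mem_nil, or_false, Finset.mem_image, Finset.mem_range]
    rcases hg with h | h | h | h | h | h | h | h | ⟨j, hj, h | h⟩
    · exact Or.inl (Or.inl h)
    · exact Or.inl (Or.inr (Or.inl h))
    · exact Or.inl (Or.inr (Or.inr (Or.inl h)))
    · exact Or.inl (Or.inr (Or.inr (Or.inr (Or.inl h))))
    · exact Or.inl (Or.inr (Or.inr (Or.inr (Or.inr (Or.inl h)))))
    · exact Or.inl (Or.inr (Or.inr (Or.inr (Or.inr (Or.inr (Or.inl h))))))
    · exact Or.inl (Or.inr (Or.inr (Or.inr (Or.inr (Or.inr (Or.inr (Or.inl h)))))))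
    · exact Or.inl (Or.inr (Or.inr (Or.inr (Or.inr (Or.inr (Or.inr (Or.inr (h))))))))
    · exact Or.inr (Or.inl ⟨j, by omega, h.symm⟩)
    · exact Or.inr (Or.inr ⟨j, by omega, h.symm⟩)
  have hfin : (⋃ g ∈ G, Z g).Finite := G.finite_toSet.biUnion fun g hg => (hZ g hg).1
  refine ⟨hfin.subset hsub, ?_⟩
  have hcard : (PiSet P r yx xy).ncard ≤ 48 * d ^ 2 * r ^ 2 := by
    calc _ ≤ (⋃ g ∈ G, Z g).ncard := Set.ncard_le_ncard hsub hfin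
      _ ≤ ∑ g ∈ G, (Z g).ncard := Finset.set_ncard_biUnion_le G Z
      _ ≤ G.card • (d * (4 * d * r)) := Finset.sum_le_card_nsmul _ _ _ fun g hg => (hZ g hg).2
      _ ≤ (12 * r) * (d * (4 * d * r)) := Nat.mul_le_mul_right _ hGcard
      _ = _ := by ring
  rw [show ((2 : ℝ)) = ((2 : ℕ) : ℝ) by norm_num, Real.rpow_natCast]
  exact_mod_cast hcard
end
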